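/- For every n ≥ 1, the number of 0's occurring in a factor of length n of the infinite binary word q = g(p) takes at most 4 distinct values; that is, if x and y are the numbers of 0's in two length-n factors of q, then |x − y| ≤ 3. -/

import Mathlib

/-- The finite block of length `n` occurring at position `i` in the infinite word `x`. -/
def FactorAt {A : Type*} (x : ℕ → A) (i n : ℕ) : List A :=
  (List.range n).map fun t => x (i + t)

/-- `w` is a (finite) factor of the infinite word `x`. -/
def IsFactor {A : Type*} (x : ℕ → A) (w : List A) : Prop :=
  ∃ i, w = FactorAt x i w.length

/-- Factor complexity of an infinite word: the number of distinct factors of length `n`. -/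
noncomputable def complexity {A : Type*} (x : ℕ → A) (n : ℕ) : ℕ :=
  Set.ncard {w : List A | w.length = n ∧ IsFactor x w}

/-- Factor complexity of a finite word: the number of distinct factors of length `n`. -/
noncomputable def complexityF {A : Type*} (z : List A) (n : ℕ) : ℕ :=
  Set.ncard {w : List A | w.length = n ∧ w <:+: z}

/-- `p` is a period of the finite word `y`:  `1 ≤ p ≤ |y|` and `y[j] = y[j+p]`
for all `0 ≤ j < |y| - p`. -/
def HasPeriod {A : Type*} [Inhabited A] (y : List A) (p : ℕ) : Prop :=
  1 ≤ p ∧ p ≤ y.length ∧ ∀ j, j + p < y.length → y.getD j default = y.getD (j + p) default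

/-- The smallest period of a finite word. -/
noncomputable def minPeriod {A : Type*} [Inhabited A] (y : List A) : ℕ :=
  sInf {p | HasPeriod y p}

/-- The exponent of a finite word: its length divided by its smallest period. -/
noncomputable def exponent {A : Type*} [Inhabited A] (y : List A) : ℚ :=
  (y.length : ℚ) / (minPeriod y : ℚ)

/-- The critical exponent of an infinite word: the supremum of the exponents of its
nonempty finite factors. -/
noncomputable def criticalExponent {A : Type*} [Inhabited A] (x : ℕ → A) : ENNReal :=
  sSup {e : ENNReal | ∃ w, IsFactor x w ∧ w ≠ [] ∧ e = ENNReal.ofReal ((exponent w : ℚ) : ℝ)}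

/-- The image of a finite word under a morphism given by its action on letters. -/
def mapWord {k : ℕ} {A : Type*} (σ : Fin k → List A) (w : List (Fin k)) : List A :=
  (w.map σ).flatten

/-- The image of an infinite word under a (nonerasing) morphism given by its action on
letters: the `n`-th letter of the concatenation `σ (x 0) ++ σ (x 1) ++ ⋯`. -/
def applyMorph {k : ℕ} {A : Type*} [Inhabited A] (σ : Fin k → List A) (x : ℕ → Fin k) :
    ℕ → A :=
  fun n => (((List.range (n + 1)).map fun i => σ (x i)).flatten).getD n default

/-- The morphism `h` with `h(0) = 01`, `h(1) = 21`, `h(2) = 0`. -/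
def hm : Fin 3 → List (Fin 3) := ![[0, 1], [2, 1], [0]]

/-- The morphism `g` with `g(0) = 011`, `g(1) = 0`, `g(2) = 01`. -/
def gm : Fin 3 → List (Fin 2) := ![[0, 1, 1], [0], [0, 1]]

/-- The abelian complexity of a binary infinite word at `n`: the number of distinct
values taken by the count of `0`'s among its length-`n` factors. -/
noncomputable def abelianComplexity (x : ℕ → Fin 2) (n : ℕ) : ℕ :=
  Set.ncard {z : ℕ | ∃ i, z = (FactorAt x i n).count 0}

/-- The image under `σ` of the prefix of length `m` of `x`. -/
def imagePrefix {k : ℕ} {A : Type*} (σ : Fin k → List A) (x : ℕ → Fin k) (m : ℕ) : List A :=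
  ((List.range m).map fun i => σ (x i)).flatten

section Morphism

variable {k : ℕ} {A : Type*} {σ : Fin k → List A} {x : ℕ → Fin k}

theorem imagePrefix_succ (m : ℕ) :
    imagePrefix σ x (m + 1) = imagePrefix σ x m ++ σ (x m) := by
  simp [imagePrefix, List.range_succ]

theorem imagePrefix_isPrefix {m m' : ℕ} (h : m ≤ m') :
    imagePrefix σ x m <+: imagePrefix σ x m' := by
  induction m', h using Nat.le_induction with
  | base => exact List.prefix_rfl
  | succ n _ ih => exact ih.trans (imagePrefix_succ (σ := σ) (x := x) n ▸ List.prefix_append _ _)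

theorem le_length_imagePrefix (hσ : ∀ a, σ a ≠ []) (m : ℕ) :
    m ≤ (imagePrefix σ x m).length := by
  induction m with
  | zero => simp
  | succ m ih =>
    have := List.length_pos_iff.2 (hσ (x m))
    rw [imagePrefix_succ, List.length_append]
    omega

theorem exists_position (hσ : ∀ a, σ a ≠ []) (n : ℕ) :
    ∃ m t, t < (σ (x m)).length ∧ n = (imagePrefix σ x m).length + t := by
  induction n with
  | zero => exact ⟨0, 0, List.length_pos_iff.2 (hσ _), by simp [imagePrefix]⟩
  | succ n ih =>
    obtain ⟨m, t, ht, rfl⟩ := ih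
    by_cases h : t + 1 < (σ (x m)).length
    · exact ⟨m, t + 1, h, by omega⟩
    · refine ⟨m + 1, 0, List.length_pos_iff.2 (hσ _), ?_⟩
      rw [imagePrefix_succ, List.length_append]
      omega

variable [Inhabited A]

theorem applyMorph_eq_getD (hσ : ∀ a, σ a ≠ []) {n m : ℕ}
    (h : n < (imagePrefix σ x m).length) :
    applyMorph σ x n = (imagePrefix σ x m).getD n default := by
  have hn : n < (imagePrefix σ x (n + 1)).length := le_length_imagePrefix hσ (n + 1)
  change (imagePrefix σ x (n + 1)).getD n default = _
  rw [List.getD_eq_getElem _ _ hn, List.getD_eq_getElem _ _ h]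
  rcases le_total (n + 1) m with hm | hm
  · exact (imagePrefix_isPrefix hm).getElem hn
  · exact ((imagePrefix_isPrefix hm).getElem h).symm

theorem applyMorph_length_add (hσ : ∀ a, σ a ≠ []) {m t : ℕ} (ht : t < (σ (x m)).length) :
    applyMorph σ x ((imagePrefix σ x m).length + t) = (σ (x m)).getD t default := by
  rw [applyMorph_eq_getD (m := m + 1) hσ (by rw [imagePrefix_succ, List.length_append]; omega),
    imagePrefix_succ, List.getD_append_right _ _ _ _ (by omega), Nat.add_sub_cancel_left]

theorem sum_applyMorph_length_add (hσ : ∀ a, σ a ≠ []) (F : A → ℝ) (m : ℕ) {t : ℕ}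
    (ht : t ≤ (σ (x m)).length) :
    ∑ i ∈ Finset.range ((imagePrefix σ x m).length + t), F (applyMorph σ x i) =
      ∑ i ∈ Finset.range m, ((σ (x i)).map F).sum + (((σ (x m)).take t).map F).sum := by
  have key : ∀ m t, t ≤ (σ (x m)).length →
      ∑ i ∈ Finset.range ((imagePrefix σ x m).length + t), F (applyMorph σ x i) =
        ∑ i ∈ Finset.range (imagePrefix σ x m).length, F (applyMorph σ x i) +
          (((σ (x m)).take t).map F).sum := by
    intro m t ht
    induction t with
    | zero => simp
    | succ t ih =>
      rw [← add_assoc, Finset.sum_range_succ, ih (by omega), applyMorph_length_add hσ ht,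
        List.take_add_one, List.getD_eq_getElem _ _ ht, List.getElem?_eq_getElem ht,
        List.map_append, List.sum_append, add_assoc]
      simp
  rw [key m t ht]
  congr 1
  clear ht
  induction m with
  | zero => simp [imagePrefix]
  | succ m ih =>
    rw [imagePrefix_succ, List.length_append, key m _ le_rfl, ih, Finset.sum_range_succ,
      List.take_length]

end Morphism

theorem hm_ne_nil (a : Fin 3) : hm a ≠ [] := by
  fin_cases a <;> simp [hm]

theorem gm_ne_nil (a : Fin 3) : gm a ≠ [] := by
  fin_cases a <;> simp [gm]

/-- Weights assigned to the letters of `p`: the `k`-th one is the pullback of the `0`-th one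
under the `k`-th power of the morphism `h`. -/
def weight (θ : ℝ) : ℕ → Fin 3 → ℝ
  | 0 => ![θ - 3, θ - 1, θ - 2]
  | k + 1 => fun a => ((hm a).map (weight θ k)).sum

/-- The region containing the first three discrepancies at the positions carrying a given
letter. -/
def InBox : Fin 3 → ℝ → ℝ → ℝ → Prop := ![
  fun x y z => (-0.6628 ≤ x ∧ x ≤ 1.0186) ∧ (-0.6588 ≤ y ∧ y ≤ 0.9975) ∧
    (-0.6548 ≤ z ∧ z ≤ 0.4324),
  fun x y z => (-1.7682 ≤ x ∧ x ≤ 0.1241) ∧ (-1.4566 ≤ y ∧ y ≤ 0.2255) ∧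
    (-0.3472 ≤ z ∧ z ≤ 1.0106),
  fun x y z => (-1.4606 ≤ x ∧ x ≤ 0.2295) ∧ (-0.3512 ≤ y ∧ y ≤ 1.0146) ∧
    (-0.1363 ≤ z ∧ z ≤ 0.9935)]

theorem exists_root : ∃ r : ℝ, 1.75487 ≤ r ∧ r ≤ 1.75488 ∧ r ^ 3 - 2 * r ^ 2 + r - 1 = 0 := by
  have hc : ContinuousOn (fun r : ℝ => r ^ 3 - 2 * r ^ 2 + r - 1) (Set.Icc 1.75487 1.75488) := by
    fun_prop
  obtain ⟨r, hr, h⟩ := intermediate_value_Icc (by norm_num) hc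
    (show (0 : ℝ) ∈ Set.Icc _ _ by constructor <;> norm_num)
  exact ⟨r, hr.1, hr.2, h⟩

section Discrepancy

variable {p : ℕ → Fin 3} {r θ : ℝ}

/-- The `k`-th discrepancy of the prefix of `p` of length `n`. -/
noncomputable def discrepancy (p : ℕ → Fin 3) (θ : ℝ) (k n : ℕ) : ℝ :=
  ∑ i ∈ Finset.range n, weight θ k (p i)

theorem discrepancy_two (hr : r ^ 3 - 2 * r ^ 2 + r - 1 = 0) (hθ : θ = 2 * r ^ 2 - 3 * r + 1)
    (n : ℕ) :
    discrepancy p θ 2 n =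
      (2 - r) * discrepancy p θ 1 n - (r ^ 2 - 2 * r + 1) * discrepancy p θ 0 n := by
  simp only [discrepancy, Finset.mul_sum, ← Finset.sum_sub_distrib]
  refine Finset.sum_congr rfl fun i _ => ?_
  generalize p i = a
  subst hθ
  fin_cases a <;> simp [weight, hm]
  · linear_combination (2 * r + 1) * hr
  · linear_combination (2 * r + 1) * hr
  · linear_combination (2 * r - 1) * hr

theorem discrepancy_three (n : ℕ) :
    discrepancy p θ 3 n =
      2 * discrepancy p θ 2 n - discrepancy p θ 1 n + discrepancy p θ 0 n := by
  simp only [discrepancy, Finset.mul_sum, ← Finset.sum_sub_distrib, ← Finset.sum_add_distrib]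
  refine Finset.sum_congr rfl fun i _ => ?_
  generalize p i = a
  fin_cases a <;> simp [weight, hm] <;> ring

theorem discrepancy_length_add (hp : applyMorph hm p = p) (k m : ℕ) {t : ℕ}
    (ht : t ≤ (hm (p m)).length) :
    discrepancy p θ k ((imagePrefix hm p m).length + t) =
      discrepancy p θ (k + 1) m + (((hm (p m)).take t).map (weight θ k)).sum := by
  have := sum_applyMorph_length_add hm_ne_nil (weight θ k) m ht
  rwa [hp] at this

theorem lt_length_imagePrefix_add (hp0 : p 0 = 0) {m t : ℕ}
    (h : 0 < (imagePrefix hm p m).length + t) : m < (imagePrefix hm p m).length + t := by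
  cases m with
  | zero => exact h
  | succ m =>
    have : m + 2 ≤ (imagePrefix hm p (m + 1)).length := by
      clear h
      induction m with
      | zero => simp [imagePrefix, hp0, hm]
      | succ m ih =>
        have := List.length_pos_iff.2 (hm_ne_nil (p (m + 1)))
        rw [imagePrefix_succ, List.length_append]
        omega
    omega

theorem inBox_discrepancy (hp0 : p 0 = 0) (hp : applyMorph hm p = p) (hr₁ : 1.75487 ≤ r)
    (hr₂ : r ≤ 1.75488) (hr : r ^ 3 - 2 * r ^ 2 + r - 1 = 0)
    (hθ : θ = 2 * r ^ 2 - 3 * r + 1) (hθ₁ : 1.8944 ≤ θ) (hθ₂ : θ ≤ 1.8947) (n : ℕ) :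
    InBox (p n) (discrepancy p θ 0 n) (discrepancy p θ 1 n) (discrepancy p θ 2 n) := by
  induction n using Nat.strong_induction_on with
  | _ n ih =>
  rcases Nat.eq_zero_or_pos n with rfl | hn
  · simp only [hp0, InBox, discrepancy]
    norm_num
  obtain ⟨m, t, ht, rfl⟩ := exists_position (x := p) hm_ne_nil n
  have hm' := ih m (lt_length_imagePrefix_add hp0 hn)
  have hlet := applyMorph_length_add hm_ne_nil ht
  rw [hp] at hlet
  have h₂ := discrepancy_two (p := p) hr hθ m
  have h₃ := discrepancy_three (p := p) (θ := θ) m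
  rw [hlet, discrepancy_length_add hp _ _ ht.le, discrepancy_length_add hp _ _ ht.le,
    discrepancy_length_add hp _ _ ht.le, h₃]
  have hq₁ : 0.5698 ≤ r ^ 2 - 2 * r + 1 := by nlinarith
  have hq₂ : r ^ 2 - 2 * r + 1 ≤ 0.5699 := by nlinarith
  generalize discrepancy p θ 0 m = x at *
  generalize discrepancy p θ 1 m = y at *
  generalize discrepancy p θ 2 m = z at *
  have hbound : -2 ≤ x ∧ x ≤ 2 ∧ -2 ≤ y ∧ y ≤ 2 := by
    generalize p m = a at hm'
    fin_cases a <;> simp [InBox] at hm' <;> refine ⟨?_, ?_, ?_, ?_⟩ <;> linarith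
  obtain ⟨hx₁, hx₂, hy₁, hy₂⟩ := hbound
  have hz₁ : z ≤ 0.24512 * y - 0.56985 * x + 0.0003 := by nlinarith
  have hz₂ : 0.24512 * y - 0.56985 * x - 0.0003 ≤ z := by nlinarith
  clear hr₁ hr₂ hr hθ hq₁ hq₂ hx₁ hx₂ hy₁ hy₂ hlet h₂ h₃ ih
  generalize p m = a at *
  have hlen : (hm a).length ≤ 2 := by
    fin_cases a <;> decide
  have ht₂ : t < 2 := ht.trans_le hlen
  interval_cases t <;> fin_cases a <;>
  first
  | exact absurd ht (by decide)
  | simp [InBox, weight, hm] at hm' ⊢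
    obtain ⟨⟨_, _⟩, ⟨_, _⟩, _, _⟩ := hm'
    refine ⟨⟨?_, ?_⟩, ⟨?_, ?_⟩, ?_, ?_⟩ <;> linarith

/-- The letter weights whose partial sums along `q` compare the number of `0`'s in a prefix
with its length. -/
def zeroWeight (θ : ℝ) : Fin 2 → ℝ := ![θ - 1, -1]

theorem sum_zeroWeight_mem (hp0 : p 0 = 0) (hp : applyMorph hm p = p) (hr₁ : 1.75487 ≤ r)
    (hr₂ : r ≤ 1.75488) (hr : r ^ 3 - 2 * r ^ 2 + r - 1 = 0)
    (hθ : θ = 2 * r ^ 2 - 3 * r + 1) (hθ₁ : 1.8944 ≤ θ) (hθ₂ : θ ≤ 1.8947) (n : ℕ) :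
    -1.7683 ≤ ∑ i ∈ Finset.range n, zeroWeight θ (applyMorph gm p i) ∧
      ∑ i ∈ Finset.range n, zeroWeight θ (applyMorph gm p i) ≤ 1.92 := by
  obtain ⟨m, t, ht, rfl⟩ := exists_position (x := p) gm_ne_nil n
  have hbox := inBox_discrepancy hp0 hp hr₁ hr₂ hr hθ hθ₁ hθ₂ m
  rw [sum_applyMorph_length_add gm_ne_nil _ _ ht.le]
  have hw : ∀ a, ((gm a).map (zeroWeight θ)).sum = weight θ 0 a := by
    intro a
    fin_cases a <;> simp [gm, zeroWeight, weight] <;> ring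
  simp only [hw]
  rw [← discrepancy]
  generalize p m = a at *
  have hlen : (gm a).length ≤ 3 := by
    fin_cases a <;> decide
  have ht₃ : t < 3 := ht.trans_le hlen
  interval_cases t <;> fin_cases a <;>
  first
  | exact absurd ht (by decide)
  | simp [InBox, zeroWeight, gm] at hbox ⊢
    constructor <;> linarith

end Discrepancy

theorem sum_zeroWeight_add (θ : ℝ) (x : ℕ → Fin 2) (i n : ℕ) :
    ∑ l ∈ Finset.range (i + n), zeroWeight θ (x l) =
      ∑ l ∈ Finset.range i, zeroWeight θ (x l) +
        (θ * ((FactorAt x i n).count 0 : ℕ) - n) := by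
  induction n with
  | zero => simp [FactorAt]
  | succ n ih =>
    have h : FactorAt x i (n + 1) = FactorAt x i n ++ [x (i + n)] := by
      simp [FactorAt, List.range_succ]
    rw [← add_assoc, Finset.sum_range_succ, ih, h, List.count_append]
    generalize x (i + n) = a
    fin_cases a <;> simp [zeroWeight] <;> ring

/-- For every `n ≥ 1`, the numbers of `0`'s in any two length-`n` factors of `q = g(p)`
differ by at most `3`. -/
theorem stmt8 (p : ℕ → Fin 3) (hp0 : p 0 = 0) (hpfix : applyMorph hm p = p) :
    ∀ n, 1 ≤ n → ∀ i j : ℕ,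
      (FactorAt (applyMorph gm p) i n).count (0 : Fin 2) ≤
        (FactorAt (applyMorph gm p) j n).count (0 : Fin 2) + 3 := by
  intro n _ i j
  obtain ⟨r, hr₁, hr₂, hr⟩ := exists_root
  obtain ⟨θ, hθ⟩ : ∃ θ, θ = 2 * r ^ 2 - 3 * r + 1 := ⟨_, rfl⟩
  have hθ₁ : 1.8944 ≤ θ := by nlinarith
  have hθ₂ : θ ≤ 1.8947 := by nlinarith
  have hb := sum_zeroWeight_mem hp0 hpfix hr₁ hr₂ hr hθ hθ₁ hθ₂
  have hi := sum_zeroWeight_add θ (applyMorph gm p) i n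
  have hj := sum_zeroWeight_add θ (applyMorph gm p) j n
  by_contra! hlt
  have hcast : ((FactorAt (applyMorph gm p) j n).count (0 : Fin 2) : ℝ) + 4 ≤
      (FactorAt (applyMorph gm p) i n).count (0 : Fin 2) := by
    exact_mod_cast hlt
  have hmul := mul_le_mul_of_nonneg_left hcast (by linarith : 0 ≤ θ)
  linarith [(hb i).1, (hb (i + n)).2, (hb j).2, (hb (j + n)).1]
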